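/- For every D there exists N such that for all n ≥ N, in the 4-regular graph game on n vertices, regardless of who has the first move, one of the players has a strategy guaranteeing that in every play following it, some position reached during the play has a connected component whose deficit is at least D. -/

import Mathlib

/-- The degree of a vertex `v` in a simple graph `G`. -/
noncomputable def deg {V : Type*} (G : SimpleGraph V) (v : V) : ℕ :=
  (G.neighborSet v).ncard

/-- A legal move in the `k`-regular graph game on `n` vertices: add an edge `uv`
with `u ≠ v`, `u, v` nonadjacent, and both of degree at most `k - 1`. -/
def GMove (k n : ℕ) (G G' : SimpleGraph (Fin n)) : Prop :=
  ∃ u v : Fin n, u ≠ v ∧ ¬G.Adj u v ∧ deg G u < k ∧ deg G v < k ∧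
    G' = G ⊔ SimpleGraph.fromEdgeSet {s(u, v)}

/-- A terminal position: no legal move remains. -/
def GTerminal (k n : ℕ) (G : SimpleGraph (Fin n)) : Prop :=
  ∀ G', ¬GMove k n G G'

/-- A strategy: a function assigning a legal move to every position admitting one. -/
def IsStrategy (k n : ℕ) (σ : SimpleGraph (Fin n) → SimpleGraph (Fin n)) : Prop :=
  ∀ G, (∃ G', GMove k n G G') → GMove k n G (σ G)

/-- `IsPlay k n σ first f T` : `f 0, f 1, …, f T` is a maximal play of the
`k`-regular graph game starting from the empty graph, in which the designated player
(who makes move `i` for `i` even iff `first = true`) moves according to `σ`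
on his turns, and the play ends at the terminal position `f T`. -/
def IsPlay (k n : ℕ) (σ : SimpleGraph (Fin n) → SimpleGraph (Fin n)) (first : Bool)
    (f : ℕ → SimpleGraph (Fin n)) (T : ℕ) : Prop :=
  f 0 = ⊥ ∧
  (∀ i < T, GMove k n (f i) (f (i + 1))) ∧
  (∀ i < T, ((i % 2 = 0) ↔ first = true) → f (i + 1) = σ (f i)) ∧
  GTerminal k n (f T)

-- The deficit (in the 4-regular game) of the connected component of `v` in `G`:
-- the sum over the vertices of that component of `4 - degree`.
open Classical in
noncomputable def componentDeficit {n : ℕ} (G : SimpleGraph (Fin n)) (v : Fin n) : ℕ :=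
  ∑ w : Fin n, if G.Reachable v w then 4 - deg G w else 0

/-- The graph with the edge `uv` added. -/
abbrev addE {n : ℕ} (G : SimpleGraph (Fin n)) (u v : Fin n) : SimpleGraph (Fin n) :=
  G ⊔ SimpleGraph.fromEdgeSet {s(u, v)}

theorem addE_adj {n : ℕ} (G : SimpleGraph (Fin n)) {u v : Fin n} (a b : Fin n) :
    (addE G u v).Adj a b ↔ G.Adj a b ∨ (a ≠ b ∧ ((a = u ∧ b = v) ∨ (a = v ∧ b = u))) := by
  simp only [SimpleGraph.sup_adj, SimpleGraph.fromEdgeSet_adj, Set.mem_singleton_iff,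
    Sym2.eq_iff]
  tauto

theorem addE_comm {n : ℕ} (G : SimpleGraph (Fin n)) (u v : Fin n) :
    addE G u v = addE G v u := by
  unfold addE
  rw [Sym2.eq_swap]

theorem le_addE {n : ℕ} (G : SimpleGraph (Fin n)) (u v : Fin n) : G ≤ addE G u v := le_sup_left

theorem addE_reach {n : ℕ} (G : SimpleGraph (Fin n)) {u v a b : Fin n}
    (h : (addE G u v).Reachable a b) :
    G.Reachable a b ∨ (G.Reachable a u ∧ G.Reachable v b) ∨
      (G.Reachable a v ∧ G.Reachable u b) := by
  obtain ⟨p⟩ := h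
  induction p with
  | nil => exact Or.inl (SimpleGraph.Reachable.refl _)
  | @cons a c b hac p ih =>
    rw [addE_adj] at hac
    rcases hac with hac | ⟨_, ⟨rfl, rfl⟩ | ⟨rfl, rfl⟩⟩
    · have := hac.reachable
      rcases ih with h | ⟨h1, h2⟩ | ⟨h1, h2⟩
      · exact Or.inl (this.trans h)
      · exact Or.inr (Or.inl ⟨this.trans h1, h2⟩)
      · exact Or.inr (Or.inr ⟨this.trans h1, h2⟩)
    · rcases ih with h | ⟨h1, h2⟩ | ⟨h1, h2⟩
      · exact Or.inr (Or.inl ⟨SimpleGraph.Reachable.refl _, h⟩)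
      · exact Or.inr (Or.inl ⟨SimpleGraph.Reachable.refl _, h2⟩)
      · exact Or.inl h2
    · rcases ih with h | ⟨h1, h2⟩ | ⟨h1, h2⟩
      · exact Or.inr (Or.inr ⟨SimpleGraph.Reachable.refl _, h⟩)
      · exact Or.inl h2
      · exact Or.inr (Or.inr ⟨SimpleGraph.Reachable.refl _, h2⟩)

theorem deg_left {n : ℕ} (G : SimpleGraph (Fin n)) {u v : Fin n} (huv : u ≠ v)
    (hn : ¬ G.Adj u v) : deg (addE G u v) u = deg G u + 1 := by
  unfold deg
  have : (addE G u v).neighborSet u = insert v (G.neighborSet u) := by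
    ext x
    simp only [SimpleGraph.mem_neighborSet, addE_adj, Set.mem_insert_iff]
    constructor
    · rintro (h | ⟨_, ⟨_, h⟩ | ⟨h, _⟩⟩)
      · exact Or.inr h
      · exact Or.inl h
      · exact absurd h huv
    · rintro (rfl | h)
      · exact Or.inr ⟨huv, Or.inl (by simp)⟩
      · exact Or.inl h
  rw [this, Set.ncard_insert_of_notMem (by simpa using hn) (Set.toFinite _)]

theorem deg_right {n : ℕ} (G : SimpleGraph (Fin n)) {u v : Fin n} (huv : u ≠ v)
    (hn : ¬ G.Adj u v) : deg (addE G u v) v = deg G v + 1 := by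
  rw [addE_comm]
  exact deg_left G huv.symm (fun h => hn h.symm)

theorem deg_other {n : ℕ} (G : SimpleGraph (Fin n)) {u v w : Fin n} (h1 : w ≠ u)
    (h2 : w ≠ v) : deg (addE G u v) w = deg G w := by
  unfold deg
  congr 1
  ext x
  simp only [SimpleGraph.mem_neighborSet, addE_adj]
  tauto

theorem deg_mono {n : ℕ} (G : SimpleGraph (Fin n)) (u v w : Fin n) :
    deg G w ≤ deg (addE G u v) w :=
  Set.ncard_le_ncard (fun _ hx => le_addE G u v hx) (Set.toFinite _)

/-- Total deficit. -/
noncomputable def totDef {n : ℕ} (G : SimpleGraph (Fin n)) : ℕ := ∑ w : Fin n, (4 - deg G w)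

/-- Potential: total deficit minus four times the number of components. -/
noncomputable def phi {n : ℕ} (G : SimpleGraph (Fin n)) : ℤ :=
  (totDef G : ℤ) - 4 * (Nat.card G.ConnectedComponent : ℤ)

/-- The vertices nonadjacent to some other vertex of their component. -/
def NC {n : ℕ} (G : SimpleGraph (Fin n)) (w : Fin n) : Prop :=
  ∃ x, G.Reachable w x ∧ w ≠ x ∧ ¬ G.Adj w x

open Classical in
/-- Total deficit of the `NC` vertices. -/
noncomputable def bad {n : ℕ} (G : SimpleGraph (Fin n)) : ℕ :=
  ∑ w : Fin n, if NC G w then 4 - deg G w else 0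

open Classical in
/-- The set of isolated vertices. -/
noncomputable def iso {n : ℕ} (G : SimpleGraph (Fin n)) : Finset (Fin n) :=
  Finset.univ.filter (fun w => deg G w = 0)

theorem totDef_addE {n : ℕ} (G : SimpleGraph (Fin n)) {u v : Fin n} (huv : u ≠ v)
    (hn : ¬ G.Adj u v) : totDef G ≤ totDef (addE G u v) + 2 := by
  unfold totDef
  have h : ∀ w : Fin n, 4 - deg G w ≤ (4 - deg (addE G u v) w) +
      ((if w = u then 1 else 0) + (if w = v then 1 else 0)) := by
    intro w
    by_cases h1 : w = u
    · subst h1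
      rw [deg_left G huv hn]
      simp only [if_true]
      omega
    · by_cases h2 : w = v
      · subst h2
        rw [deg_right G huv hn]
        simp only [if_true]
        omega
      · rw [deg_other G h1 h2]
        omega
  refine (Finset.sum_le_sum (fun w _ => h w)).trans ?_
  rw [Finset.sum_add_distrib, Finset.sum_add_distrib]
  simp

theorem cc_surj {n : ℕ} (G : SimpleGraph (Fin n)) (u v : Fin n) :
    Function.Surjective
      (SimpleGraph.ConnectedComponent.map (SimpleGraph.Hom.ofLE (le_addE G u v))) := by
  intro C
  induction C using SimpleGraph.ConnectedComponent.ind with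
  | h w => exact ⟨G.connectedComponentMk w, rfl⟩

theorem card_cc_le {n : ℕ} (G : SimpleGraph (Fin n)) (u v : Fin n) :
    Nat.card (addE G u v).ConnectedComponent ≤ Nat.card G.ConnectedComponent :=
  Nat.card_le_card_of_surjective _ (cc_surj G u v)

theorem card_cc_lt {n : ℕ} (G : SimpleGraph (Fin n)) {u v : Fin n} (huv : u ≠ v)
    (h : ¬ G.Reachable u v) :
    Nat.card (addE G u v).ConnectedComponent < Nat.card G.ConnectedComponent := by
  rw [← not_le]
  intro hle
  have hs := cc_surj G u v
  have hb := (Nat.bijective_iff_surjective_and_card _).2 ⟨hs, le_antisymm hle (card_cc_le G u v)⟩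
  apply h
  rw [← SimpleGraph.ConnectedComponent.eq]
  apply hb.1
  simp only [SimpleGraph.ConnectedComponent.map_mk, SimpleGraph.Hom.coe_ofLE, id]
  rw [SimpleGraph.ConnectedComponent.eq]
  exact SimpleGraph.Adj.reachable ((addE_adj G u v).2 (Or.inr ⟨huv, Or.inl ⟨rfl, rfl⟩⟩))

theorem phi_any {n : ℕ} (G : SimpleGraph (Fin n)) {u v : Fin n} (huv : u ≠ v)
    (hn : ¬ G.Adj u v) : phi G - 2 ≤ phi (addE G u v) := by
  have h1 := totDef_addE G huv hn
  have h2 := card_cc_le G u v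
  unfold phi
  omega

theorem phi_merge {n : ℕ} (G : SimpleGraph (Fin n)) {u v : Fin n} (huv : u ≠ v)
    (h : ¬ G.Reachable u v) : phi G + 2 ≤ phi (addE G u v) := by
  have h1 := totDef_addE G huv (fun h' => h h'.reachable)
  have h2 := card_cc_lt G huv h
  unfold phi
  omega

theorem bad_merge {n : ℕ} (G : SimpleGraph (Fin n)) {u v : Fin n}
    (hu : deg G u < 4) (hv : deg G v < 4) : bad (addE G u v) ≤ bad G + 32 := by
  classical
  let S : Finset (Fin n) := insert u (insert v ((G.neighborSet u).toFinset ∪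
    (G.neighborSet v).toFinset))
  have hS : S.card ≤ 8 := by
    have h1 : (G.neighborSet u).toFinset.card < 4 := by
      rw [← Set.ncard_eq_toFinset_card']; exact hu
    have h2 : (G.neighborSet v).toFinset.card < 4 := by
      rw [← Set.ncard_eq_toFinset_card']; exact hv
    have h3 := Finset.card_insert_le u (insert v ((G.neighborSet u).toFinset ∪
      (G.neighborSet v).toFinset))
    have h4 := Finset.card_insert_le v ((G.neighborSet u).toFinset ∪ (G.neighborSet v).toFinset)
    have h5 := Finset.card_union_le (G.neighborSet u).toFinset (G.neighborSet v).toFinset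
    simp only [S]
    omega
  have key : ∀ w, NC (addE G u v) w → ¬ NC G w → w ∈ S := by
    intro w hw hw'
    have aux : ∀ z, G.Reachable w z → w = z ∨ G.Adj z w := by
      intro z hz
      by_contra hcon
      rw [not_or] at hcon
      exact hw' ⟨z, hz, hcon.1, fun h => hcon.2 h.symm⟩
    obtain ⟨x, hx, hne, hna⟩ := hw
    simp only [S, Finset.mem_insert, Finset.mem_union, Set.mem_toFinset,
      SimpleGraph.mem_neighborSet]
    rcases addE_reach G hx with h | ⟨h, _⟩ | ⟨h, _⟩
    · exact absurd ⟨x, h, hne, fun h' => hna (le_addE G u v h')⟩ hw'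
    · have := aux u h
      tauto
    · have := aux v h
      tauto
  have h : ∀ w : Fin n, (if NC (addE G u v) w then 4 - deg (addE G u v) w else 0) ≤
      (if NC G w then 4 - deg G w else 0) + (if w ∈ S then 4 else 0) := by
    intro w
    have hm := deg_mono G u v w
    have hk := key w
    split_ifs <;> first | omega | (exfalso; tauto)
  unfold bad
  refine (Finset.sum_le_sum (fun w _ => h w)).trans ?_
  rw [Finset.sum_add_distrib, Finset.sum_ite_mem, Finset.univ_inter, Finset.sum_const]
  simp only [smul_eq_mul]
  omega

theorem bad_internal {n : ℕ} (G : SimpleGraph (Fin n)) {u v : Fin n} (huv : u ≠ v)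
    (hn : ¬ G.Adj u v) (hr : G.Reachable u v)
    (hu : deg G u < 4) (hv : deg G v < 4) : bad (addE G u v) + 2 ≤ bad G := by
  classical
  have key : ∀ w, NC (addE G u v) w → NC G w := by
    rintro w ⟨x, hx, hne, hna⟩
    refine ⟨x, ?_, hne, fun h' => hna (le_addE G u v h')⟩
    rcases addE_reach G hx with h | ⟨h1, h2⟩ | ⟨h1, h2⟩
    · exact h
    · exact h1.trans (hr.trans h2)
    · exact h1.trans (hr.symm.trans h2)
  have hNu : NC G u := ⟨v, hr, huv, hn⟩
  have hNv : NC G v := ⟨u, hr.symm, huv.symm, fun h => hn h.symm⟩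
  have h : ∀ w : Fin n, (if NC (addE G u v) w then 4 - deg (addE G u v) w else 0) +
      ((if w = u then 1 else 0) + (if w = v then 1 else 0)) ≤
      (if NC G w then 4 - deg G w else 0) := by
    intro w
    have hk := key w
    by_cases h1 : w = u
    · subst h1
      rw [deg_left G huv hn, if_pos hNu, if_pos rfl, if_neg huv]
      split_ifs <;> omega
    · by_cases h2 : w = v
      · subst h2
        rw [deg_right G huv hn, if_pos hNv, if_pos rfl, if_neg h1]
        split_ifs <;> omega
      · rw [deg_other G h1 h2, if_neg h1, if_neg h2]
        split_ifs <;> first | omega | (exfalso; tauto)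
  have := Finset.sum_le_sum (s := Finset.univ) (fun w _ => h w)
  rw [Finset.sum_add_distrib, Finset.sum_add_distrib] at this
  simpa [bad] using this

theorem reach_of_deg_zero {n : ℕ} (G : SimpleGraph (Fin n)) {u w : Fin n} (hu : deg G u = 0)
    (h : G.Reachable u w) : u = w := by
  obtain ⟨p⟩ := h
  cases p with
  | nil => rfl
  | cons hadj p =>
    exfalso
    unfold deg at hu
    rw [Set.ncard_eq_zero (Set.toFinite _)] at hu
    have : _ ∈ G.neighborSet u := hadj
    rw [hu] at this
    exact this

theorem bad_iso {n : ℕ} (G : SimpleGraph (Fin n)) {u v : Fin n} (huv : u ≠ v)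
    (hu : deg G u = 0) (hv : deg G v = 0) : bad (addE G u v) ≤ bad G := by
  classical
  have key : ∀ w, NC (addE G u v) w → NC G w := by
    rintro w ⟨x, hx, hne, hna⟩
    rcases addE_reach G hx with h | ⟨h1, h2⟩ | ⟨h1, h2⟩
    · exact ⟨x, h, hne, fun h' => hna (le_addE G u v h')⟩
    · have e1 := reach_of_deg_zero G hu h1.symm
      have e2 := reach_of_deg_zero G hv h2
      subst e1 e2
      exact absurd ((addE_adj G _ _).2 (Or.inr ⟨hne, Or.inl ⟨rfl, rfl⟩⟩)) hna
    · have e1 := reach_of_deg_zero G hv h1.symm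
      have e2 := reach_of_deg_zero G hu h2
      subst e1 e2
      exact absurd ((addE_adj G _ _).2 (Or.inr ⟨hne, Or.inr ⟨rfl, rfl⟩⟩)) hna
  unfold bad
  refine Finset.sum_le_sum (fun w _ => ?_)
  have hk := key w
  have hm := deg_mono G u v w
  split_ifs <;> first | omega | (exfalso; tauto)

theorem iso_addE {n : ℕ} (G : SimpleGraph (Fin n)) (u v : Fin n) :
    (iso G).card ≤ (iso (addE G u v)).card + 2 := by
  classical
  have h : iso G ⊆ insert u (insert v (iso (addE G u v))) := by
    intro w hw
    simp only [iso, Finset.mem_insert, Finset.mem_filter, Finset.mem_univ, true_and] at hw ⊢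
    by_cases h1 : w = u
    · exact Or.inl h1
    · by_cases h2 : w = v
      · exact Or.inr (Or.inl h2)
      · rw [deg_other G h1 h2]
        exact Or.inr (Or.inr hw)
  have h1 := Finset.card_le_card h
  have h2 := Finset.card_insert_le u (insert v (iso (addE G u v)))
  have h3 := Finset.card_insert_le v (iso (addE G u v))
  omega

/-- A move joining two isolated vertices. -/
def IsoMove {n : ℕ} (G G' : SimpleGraph (Fin n)) : Prop :=
  ∃ u v : Fin n, u ≠ v ∧ deg G u = 0 ∧ deg G v = 0 ∧ G' = addE G u v

/-- A move merging two components. -/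
def MergeMove {n : ℕ} (G G' : SimpleGraph (Fin n)) : Prop :=
  ∃ u v : Fin n, u ≠ v ∧ ¬ G.Reachable u v ∧ deg G u < 4 ∧ deg G v < 4 ∧ G' = addE G u v

theorem MergeMove.move {n : ℕ} {G G' : SimpleGraph (Fin n)} (h : MergeMove G G') :
    GMove 4 n G G' := by
  obtain ⟨u, v, h1, h2, h3, h4, h5⟩ := h
  exact ⟨u, v, h1, fun h => h2 h.reachable, h3, h4, h5⟩

theorem IsoMove.merge {n : ℕ} {G G' : SimpleGraph (Fin n)} (h : IsoMove G G') :
    MergeMove G G' := by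
  obtain ⟨u, v, h1, h2, h3, h5⟩ := h
  exact ⟨u, v, h1, fun h => h1 (reach_of_deg_zero G h2 h), by omega, by omega, h5⟩

theorem MergeMove.phi_le {n : ℕ} {G G' : SimpleGraph (Fin n)} (h : MergeMove G G') :
    phi G + 2 ≤ phi G' := by
  obtain ⟨u, v, h1, h2, h3, h4, rfl⟩ := h
  exact phi_merge G h1 h2

theorem GMove_phi {n : ℕ} {G G' : SimpleGraph (Fin n)} (h : GMove 4 n G G') :
    phi G - 2 ≤ phi G' := by
  obtain ⟨u, v, h1, h2, h3, h4, rfl⟩ := h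
  exact phi_any G h1 h2

theorem GMove_iso {n : ℕ} {G G' : SimpleGraph (Fin n)} (h : GMove 4 n G G') :
    (iso G).card ≤ (iso G').card + 2 := by
  obtain ⟨u, v, h1, h2, h3, h4, rfl⟩ := h
  exact iso_addE G u v

/-- The opening potential. -/
noncomputable def pot {n : ℕ} (G : SimpleGraph (Fin n)) : ℤ := 10 * phi G - bad G

theorem GMove_pot {n : ℕ} {G G' : SimpleGraph (Fin n)} (h : GMove 4 n G G') :
    pot G - 18 ≤ pot G' := by
  obtain ⟨u, v, h1, h2, h3, h4, rfl⟩ := h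
  unfold pot
  by_cases hr : G.Reachable u v
  · have e1 := phi_any G h1 h2
    have e2 := bad_internal G h1 h2 hr h3 h4
    change _ ≤ 10 * phi (addE G u v) - (bad (addE G u v) : ℤ)
    omega
  · have e1 := phi_merge G h1 hr
    have e2 := bad_merge G h3 h4
    change _ ≤ 10 * phi (addE G u v) - (bad (addE G u v) : ℤ)
    omega

theorem IsoMove.pot_le {n : ℕ} {G G' : SimpleGraph (Fin n)} (h : IsoMove G G') :
    pot G + 20 ≤ pot G' := by
  have e1 := h.merge.phi_le
  obtain ⟨u, v, h1, h2, h3, rfl⟩ := h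
  have e2 := bad_iso G h1 h2 h3
  unfold pot
  omega

theorem exists_isoMove {n : ℕ} {G : SimpleGraph (Fin n)} (h : 2 ≤ (iso G).card) :
    ∃ G', IsoMove G G' := by
  classical
  obtain ⟨u, hu, v, hv, huv⟩ := Finset.one_lt_card.1 h
  simp only [iso, Finset.mem_filter, Finset.mem_univ, true_and] at hu hv
  exact ⟨_, u, v, huv, hu, hv, rfl⟩

open Classical in
/-- The strategy of Builder. -/
noncomputable def strat (n : ℕ) (G : SimpleGraph (Fin n)) : SimpleGraph (Fin n) :=
  if h : ∃ G', IsoMove G G' then h.choose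
  else if h : ∃ G', MergeMove G G' then h.choose
  else if h : ∃ G', GMove 4 n G G' then h.choose
  else G

theorem strat_iso {n : ℕ} {G : SimpleGraph (Fin n)} (h : ∃ G', IsoMove G G') :
    IsoMove G (strat n G) := by
  unfold strat
  rw [dif_pos h]
  exact h.choose_spec

theorem strat_merge {n : ℕ} {G : SimpleGraph (Fin n)} (h : ∃ G', MergeMove G G') :
    MergeMove G (strat n G) := by
  by_cases h' : ∃ G', IsoMove G G'
  · exact (strat_iso h').merge
  · unfold strat
    rw [dif_neg h', dif_pos h]
    exact h.choose_spec

theorem strat_isStrategy (n : ℕ) : IsStrategy 4 n (strat n) := by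
  intro G hG
  by_cases h : ∃ G', MergeMove G G'
  · exact (strat_merge h).move
  · have h' : ¬ ∃ G', IsoMove G G' := fun ⟨G', hG'⟩ => h ⟨G', hG'.merge⟩
    unfold strat
    rw [dif_neg h', dif_neg h, dif_pos hG]
    exact hG.choose_spec

theorem no_merge_deficit {n : ℕ} (hn : 0 < n) {G : SimpleGraph (Fin n)} {D : ℕ}
    (h : ¬ ∃ G', MergeMove G G') (hD : (D : ℤ) ≤ phi G) :
    ∃ v : Fin n, D ≤ componentDeficit G v := by
  classical
  have hD' : D ≤ totDef G := by
    unfold phi at hD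
    omega
  by_cases hv : ∃ v : Fin n, deg G v < 4
  · obtain ⟨v, hv⟩ := hv
    refine ⟨v, hD'.trans ?_⟩
    unfold totDef componentDeficit
    refine Finset.sum_le_sum (fun w _ => ?_)
    split_ifs with hr
    · exact le_rfl
    · by_contra hcon
      have hne : v ≠ w := by
        rintro rfl
        exact hr (SimpleGraph.Reachable.refl _)
      exact h ⟨_, v, w, hne, hr, hv, by omega, rfl⟩
  · push Not at hv
    have : totDef G = 0 := by
      unfold totDef
      exact Finset.sum_eq_zero (fun w _ => by have := hv w; omega)
    exact ⟨⟨0, hn⟩, by omega⟩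

theorem deg_bot {n : ℕ} (w : Fin n) : deg (⊥ : SimpleGraph (Fin n)) w = 0 := by
  unfold deg
  rw [Set.ncard_eq_zero (Set.toFinite _)]
  ext x
  simp

theorem iso_bot (n : ℕ) : (iso (⊥ : SimpleGraph (Fin n))).card = n := by
  classical
  unfold iso
  rw [Finset.filter_true_of_mem (fun w _ => deg_bot w)]
  simp

theorem pot_bot (n : ℕ) : 0 ≤ pot (⊥ : SimpleGraph (Fin n)) := by
  classical
  have h1 : totDef (⊥ : SimpleGraph (Fin n)) = 4 * n := by
    unfold totDef
    simp [deg_bot, mul_comm]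
  have h2 : Nat.card (⊥ : SimpleGraph (Fin n)).ConnectedComponent ≤ n := by
    have := Nat.card_le_card_of_surjective (⊥ : SimpleGraph (Fin n)).connectedComponentMk
      (fun C => C.exists_rep)
    simpa using this
  have h3 : bad (⊥ : SimpleGraph (Fin n)) = 0 := by
    unfold bad
    refine Finset.sum_eq_zero (fun w _ => ?_)
    rw [if_neg]
    rintro ⟨x, hx, hne, _⟩
    exact hne (reach_of_deg_zero _ (deg_bot w) hx)
  unfold pot phi
  omega

/-- For every `D` there is `N` such that for all `n ≥ N`, in the 4-regular graph game
on `n` vertices, regardless of who has the first move, a player has a strategy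
guaranteeing that in every play following it, some position reached during the play
has a connected component of deficit at least `D`. -/
theorem four_regular_game_large_deficit_component (D : ℕ) :
    ∃ N : ℕ, ∀ n ≥ N, ∀ first : Bool,
      ∃ σ : SimpleGraph (Fin n) → SimpleGraph (Fin n), IsStrategy 4 n σ ∧
        ∀ (f : ℕ → SimpleGraph (Fin n)) (T : ℕ), IsPlay 4 n σ first f T →
          ∃ i ≤ T, ∃ v : Fin n, D ≤ componentDeficit (f i) v := by
  refine ⟨2 * (10 * D + 39) + 2, fun n hn first => ⟨strat n, strat_isStrategy n, ?_⟩⟩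
  rintro f T ⟨h0, hmove, hstrat, hterm⟩
  have hiso : ∀ i ≤ T, n ≤ (iso (f i)).card + 2 * i := by
    intro i
    induction i with
    | zero => intro _; rw [h0, iso_bot]; omega
    | succ i ih =>
      intro hi
      have h1 := ih (by omega)
      have h2 := GMove_iso (hmove i (by omega))
      omega
  have hT : 10 * D + 39 < T := by
    by_contra hcon
    have h1 := hiso T le_rfl
    obtain ⟨G', hG'⟩ := exists_isoMove (G := f T) (by omega)
    exact hterm G' hG'.merge.move
  have hopen : ∀ i ≤ 10 * D + 39, (i : ℤ) - 19 ≤ pot (f i) ∧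
      (¬ ((i % 2 = 0) ↔ first = true) → (i : ℤ) ≤ pot (f i)) := by
    intro i
    induction i with
    | zero =>
      intro _
      have := pot_bot n
      rw [h0]
      exact ⟨by push_cast; omega, fun _ => by push_cast; omega⟩
    | succ i ih =>
      intro hi
      obtain ⟨h1, h2⟩ := ih (by omega)
      by_cases hb : ((i % 2 = 0) ↔ first = true)
      · have h3 := hiso i (by omega)
        have h4 := (strat_iso (exists_isoMove (G := f i) (by omega))).pot_le
        rw [← hstrat i (by omega) hb] at h4
        exact ⟨by push_cast; omega, fun _ => by push_cast; omega⟩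
      · have h3 := h2 hb
        have h4 := GMove_pot (hmove i (by omega))
        refine ⟨by push_cast; omega, fun h => absurd ?_ h⟩
        have hp : (i + 1) % 2 = 0 ↔ ¬ (i % 2 = 0) := by omega
        rw [hp]
        tauto
  by_contra hcon
  have hmerge : ∀ i ≤ T, (D : ℤ) ≤ phi (f i) → ∃ G', MergeMove (f i) G' := by
    intro i hi hphi
    by_contra hno
    obtain ⟨v, hv⟩ := no_merge_deficit (by omega) hno hphi
    exact hcon ⟨i, hi, v, hv⟩
  have hmain : ∀ j, 10 * D + 39 + j ≤ T → (D : ℤ) ≤ phi (f (10 * D + 39 + j)) ∧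
      (¬ (((10 * D + 39 + j) % 2 = 0) ↔ first = true) →
        (D : ℤ) + 2 ≤ phi (f (10 * D + 39 + j))) := by
    intro j
    induction j with
    | zero =>
      intro _
      have h1 := (hopen (10 * D + 39) le_rfl).1
      unfold pot at h1
      push_cast at h1
      rw [Nat.add_zero]
      exact ⟨by omega, fun _ => by omega⟩
    | succ j ih =>
      intro hj
      obtain ⟨h1, h2⟩ := ih (by omega)
      rw [← Nat.add_assoc]
      have hj' : 10 * D + 39 + j < T := by omega
      generalize 10 * D + 39 + j = i at h1 h2 hj' ⊢
      by_cases hb : ((i % 2 = 0) ↔ first = true)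
      · have h4 := (strat_merge (hmerge i (by omega) h1)).phi_le
        rw [← hstrat i (by omega) hb] at h4
        exact ⟨by omega, fun _ => by omega⟩
      · have h3 := h2 hb
        have h4 := GMove_phi (hmove i (by omega))
        refine ⟨by omega, fun h => absurd ?_ h⟩
        have hp : (i + 1) % 2 = 0 ↔ ¬ (i % 2 = 0) := by omega
        rw [hp]
        tauto
  obtain ⟨j, rfl⟩ : ∃ j, T = 10 * D + 39 + j := ⟨T - (10 * D + 39), by omega⟩
  obtain ⟨G', hG'⟩ := hmerge _ le_rfl (hmain j le_rfl).1
  exact hterm G' hG'.move
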